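/- Let K ≥ 1, let a₁, …, a_K > 0, let S₁, …, S_K be independent real random variables with S_k Gamma(2,a_k)-distributed, and let J be uniformly distributed on {1, …, K} and independent of (S₁, …, S_K). Then E[log(1 + S_J)] = 1 + (1/K)·∑_{k=1}^{K} (1 - a_k)·e^{a_k}·∫_{a_k}^∞ (e^{-t}/t) dt. (This is the ergodic rate of the user selected by the Random User Selection scheme in single-user mode, with a_k = σ̃²/g_k.) -/

import Mathlib

open MeasureTheory Real Set
open scoped ENNReal

/-- The Gamma(2, a) law: density `a² · x · e^{-a·x}` on `(0, ∞)` (shape 2, rate `a`). -/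
noncomputable def gammaLaw (a : ℝ) : Measure ℝ :=
  volume.withDensity fun x =>
    ENNReal.ofReal (if 0 < x then a ^ 2 * x * Real.exp (-(a * x)) else 0)

/-- The uniform law on a finite type (here `Fin K`). -/
noncomputable def unifFin (K : ℕ) : Measure (Fin K) := (K : ℝ≥0∞)⁻¹ • Measure.count

/-- `gammaLaw` is Mathlib's Gamma measure of shape `2`. -/
theorem gammaLaw_eq_gammaMeasure (a : ℝ) :
    gammaLaw a = ProbabilityTheory.gammaMeasure 2 a := by
  unfold gammaLaw ProbabilityTheory.gammaMeasure
  congr 1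
  funext x
  rw [ProbabilityTheory.gammaPDF_eq]
  congr 1
  have h2 : Real.Gamma 2 = 1 := by simp
  rcases lt_trichotomy x 0 with hx | hx | hx
  · rw [if_neg hx.not_gt, if_neg hx.not_ge]
  · simp [hx, show (2 : ℝ) - 1 = 1 by norm_num]
  · rw [if_pos hx, if_pos hx.le, h2, show (2 : ℝ) - 1 = 1 by norm_num]
    norm_num

theorem isProbabilityMeasure_gammaLaw {a : ℝ} (ha : 0 < a) :
    IsProbabilityMeasure (gammaLaw a) := by
  rw [gammaLaw_eq_gammaMeasure]
  exact ProbabilityTheory.isProbabilityMeasure_gammaMeasure two_pos ha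

theorem measurable_gammaLaw_density (a : ℝ) :
    Measurable fun x : ℝ => if 0 < x then a ^ 2 * x * Real.exp (-(a * x)) else 0 :=
  Measurable.ite measurableSet_Ioi (by fun_prop) measurable_const

theorem gammaLaw_density_nonneg (a x : ℝ) :
    0 ≤ if 0 < x then a ^ 2 * x * Real.exp (-(a * x)) else 0 := by
  split_ifs <;> positivity

theorem integrable_gammaLaw_iff (a : ℝ) (f : ℝ → ℝ) :
    Integrable f (gammaLaw a) ↔
      IntegrableOn (fun x => a ^ 2 * x * Real.exp (-(a * x)) * f x) (Ioi 0) := by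
  unfold gammaLaw
  rw [integrable_withDensity_iff_integrable_smul' (measurable_gammaLaw_density a).ennreal_ofReal
    (by simp), ← integrable_indicator_iff measurableSet_Ioi]
  refine integrable_congr (.of_forall fun x => ?_)
  simp only [ENNReal.toReal_ofReal (gammaLaw_density_nonneg a x), indicator, mem_Ioi, smul_eq_mul]
  split_ifs <;> simp

theorem integral_gammaLaw (a : ℝ) (f : ℝ → ℝ) :
    ∫ x, f x ∂gammaLaw a = ∫ x in Ioi 0, a ^ 2 * x * Real.exp (-(a * x)) * f x := by
  unfold gammaLaw
  rw [integral_withDensity_eq_integral_toReal_smul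
    (measurable_gammaLaw_density a).ennreal_ofReal (by simp),
    ← integral_indicator measurableSet_Ioi]
  refine integral_congr_ae (.of_forall fun x => ?_)
  simp only [ENNReal.toReal_ofReal (gammaLaw_density_nonneg a x), indicator, mem_Ioi, smul_eq_mul]
  split_ifs <;> simp

theorem integrableOn_mul_exp_neg_mul_log_one_add {a : ℝ} (ha : 0 < a) :
    IntegrableOn (fun x => a ^ 2 * x * Real.exp (-(a * x)) * Real.log (1 + x)) (Ioi 0) := by
  have hdom : IntegrableOn (fun x : ℝ => a ^ 2 * (x ^ (2 : ℝ) * Real.exp (-a * x))) (Ioi 0) := by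
    have h := integrableOn_rpow_mul_exp_neg_mul_rpow (s := 2) (p := 1) (by norm_num) one_pos ha
    simp only [Real.rpow_one] at h
    exact h.const_mul _
  refine Integrable.mono' hdom (by fun_prop) ?_
  filter_upwards [ae_restrict_mem measurableSet_Ioi] with x hx
  have hx : 0 < x := hx
  have hlog : 0 ≤ Real.log (1 + x) := Real.log_nonneg (by linarith)
  have hle : Real.log (1 + x) ≤ x := by
    linarith [Real.log_le_sub_one_of_pos (show 0 < 1 + x by linarith)]
  rw [Real.norm_of_nonneg (by positivity), Real.rpow_two, neg_mul]
  calc a ^ 2 * x * Real.exp (-(a * x)) * Real.log (1 + x)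
      ≤ a ^ 2 * x * Real.exp (-(a * x)) * x := by gcongr
    _ = a ^ 2 * (x ^ 2 * Real.exp (-(a * x))) := by ring

theorem integrableOn_exp_neg_mul {a : ℝ} (ha : 0 < a) :
    IntegrableOn (fun x : ℝ => Real.exp (-(a * x))) (Ioi 0) := by
  simpa only [neg_mul] using exp_neg_integrableOn_Ioi 0 ha

theorem integrableOn_exp_neg_mul_div_one_add {a : ℝ} (ha : 0 < a) :
    IntegrableOn (fun x : ℝ => Real.exp (-(a * x)) / (1 + x)) (Ioi 0) := by
  refine Integrable.mono' (integrableOn_exp_neg_mul ha)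
    (by fun_prop : Measurable _).aestronglyMeasurable ?_
  filter_upwards [ae_restrict_mem measurableSet_Ioi] with x hx
  have hx : 0 < x := hx
  rw [Real.norm_of_nonneg (by positivity)]
  exact div_le_self (Real.exp_pos _).le (by linarith)

theorem integral_exp_neg_mul {a : ℝ} (ha : 0 < a) :
    ∫ x in Ioi (0 : ℝ), Real.exp (-(a * x)) = 1 / a := by
  have h := integral_exp_mul_Ioi (neg_lt_zero.mpr ha) 0
  simp only [neg_mul] at h
  simpa using h

theorem integral_exp_neg_mul_div_one_add {a : ℝ} (ha : 0 < a) :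
    ∫ x in Ioi (0 : ℝ), Real.exp (-(a * x)) / (1 + x)
      = Real.exp a * ∫ t in Ioi a, Real.exp (-t) / t := by
  have hscale := integral_comp_mul_left_Ioi (fun t => Real.exp (-t) / t) 1 ha
  have hshift := (measurePreserving_add_right volume (1 : ℝ)).setIntegral_preimage_emb
    (measurableEmbedding_addRight 1) (fun x => Real.exp (-(a * x)) / (a * x)) (Ioi 1)
  rw [mul_one, smul_eq_mul] at hscale
  rw [hscale, preimage_add_const_Ioi, sub_self] at hshift
  have hcongr : ∀ x : ℝ, Real.exp (-(a * x)) / (1 + x)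
      = (a * Real.exp a) * (Real.exp (-(a * (x + 1))) / (a * (x + 1))) := by
    intro x
    rw [show -(a * (x + 1)) = -(a * x) - a by ring, Real.exp_sub, add_comm 1 x]
    rcases eq_or_ne (x + 1) 0 with h | h
    · simp [h]
    · field_simp
  simp_rw [hcongr]
  rw [integral_const_mul, hshift]
  field_simp

/-- Boundary term of the integration by parts: it vanishes at infinity. -/
theorem tendsto_one_add_mul_mul_exp_neg_mul_log {a : ℝ} (ha : 0 < a) :
    Filter.Tendsto (fun x : ℝ => -((1 + a * x) * Real.exp (-(a * x)) * Real.log (1 + x)))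
      Filter.atTop (nhds 0) := by
  have h (s : ℝ) : Filter.Tendsto (fun x : ℝ => x ^ s * Real.exp (-a * x))
      Filter.atTop (nhds 0) := tendsto_rpow_mul_exp_neg_mul_atTop_nhds_zero s a ha
  have hsum := (h 1).add ((h 2).const_mul a)
  rw [mul_zero, add_zero] at hsum
  rw [← neg_zero]
  refine (squeeze_zero' ?_ ?_ hsum).neg
  · filter_upwards [Filter.eventually_ge_atTop 0] with x hx
    have := Real.log_nonneg (show 1 ≤ 1 + x by linarith)
    positivity
  · filter_upwards [Filter.eventually_ge_atTop 0] with x hx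
    have hle : Real.log (1 + x) ≤ x := by
      linarith [Real.log_le_sub_one_of_pos (show 0 < 1 + x by linarith)]
    rw [Real.rpow_one, Real.rpow_two, neg_mul]
    calc (1 + a * x) * Real.exp (-(a * x)) * Real.log (1 + x)
        ≤ (1 + a * x) * Real.exp (-(a * x)) * x := by gcongr
      _ = _ := by ring

theorem integrable_log_one_add_gammaLaw {a : ℝ} (ha : 0 < a) :
    Integrable (fun x => Real.log (1 + x)) (gammaLaw a) :=
  (integrable_gammaLaw_iff a _).mpr (integrableOn_mul_exp_neg_mul_log_one_add ha)

/-- Expectation of `log (1 + S)` for `S` Gamma(2, a)-distributed. -/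
theorem integral_log_one_add_gammaLaw {a : ℝ} (ha : 0 < a) :
    ∫ x, Real.log (1 + x) ∂gammaLaw a
      = 1 + (1 - a) * Real.exp a * ∫ t in Ioi a, Real.exp (-t) / t := by
  have hI := integrableOn_mul_exp_neg_mul_log_one_add ha
  have hE := (integrableOn_exp_neg_mul ha).const_mul a
  have hD := (integrableOn_exp_neg_mul_div_one_add ha).const_mul (1 - a)
  have hderiv : ∀ x ∈ Ici (0 : ℝ),
      HasDerivAt (fun x : ℝ => -((1 + a * x) * Real.exp (-(a * x)) * Real.log (1 + x)))
        (a ^ 2 * x * Real.exp (-(a * x)) * Real.log (1 + x)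
          - (a * Real.exp (-(a * x)) + (1 - a) * (Real.exp (-(a * x)) / (1 + x)))) x := by
    intro x hx
    have hx1 : 1 + x ≠ 0 := by have : 0 ≤ x := hx; positivity
    have hlin : HasDerivAt (fun x : ℝ => a * x) a x := by
      simpa using (hasDerivAt_id x).const_mul a
    have hlog := ((hasDerivAt_id x).const_add 1).log hx1
    refine (((hlin.const_add 1).mul hlin.neg.exp).mul hlog).neg.congr_deriv ?_
    simp only [id, Pi.neg_apply, Pi.mul_apply]
    field_simp
    ring
  have hFTC := integral_Ioi_of_hasDerivAt_of_tendsto' hderiv (hI.sub (hE.add hD))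
    (tendsto_one_add_mul_mul_exp_neg_mul_log ha)
  have hsub := integral_sub hI (hE.add hD)
  have hsum := integral_add hE hD
  simp only [Pi.add_apply] at hsub
  rw [hsub] at hFTC
  rw [integral_const_mul, integral_const_mul, integral_exp_neg_mul ha,
    integral_exp_neg_mul_div_one_add ha, mul_one_div_cancel ha.ne', ← mul_assoc] at hsum
  rw [hsum] at hFTC
  rw [integral_gammaLaw, sub_eq_zero.mp (hFTC.trans (by simp))]

theorem integral_unifFin (K : ℕ) (f : Fin K → ℝ) :
    ∫ k, f k ∂unifFin K = (1 / (K : ℝ)) * ∑ k, f k := by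
  unfold unifFin
  rw [integral_smul_measure, integral_count]
  simp

theorem isFiniteMeasure_unifFin {K : ℕ} (hK : 1 ≤ K) : IsFiniteMeasure (unifFin K) := by
  unfold unifFin
  refine Measure.smul_finite _ (ENNReal.inv_ne_top.mpr ?_)
  exact_mod_cast (Nat.one_le_iff_ne_zero.mp hK)

/-- Ergodic rate of the user selected by the RUS scheme in single-user
mode: `K ≥ 1`, `S₁, …, S_K` independent with `S_k ~ Gamma(2, a_k)`, `J` uniform on
`{1, …, K}` independent of the `S_k` (the joint law is the product of the marginals).
Then `E[log(1 + S_J)] = 1 + (1/K)·∑_k (1 - a_k)·e^{a_k}·∫_{a_k}^∞ (e^{-t}/t) dt`. -/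
theorem rus_su_mode_ergodic_rate {Ω : Type*} [MeasurableSpace Ω]
    (μ : Measure Ω) [IsProbabilityMeasure μ]
    (K : ℕ) (hK : 1 ≤ K) (a : Fin K → ℝ) (ha : ∀ k, 0 < a k)
    (S : Fin K → Ω → ℝ) (J : Ω → Fin K)
    (hSmeas : ∀ k, Measurable (S k)) (hJmeas : Measurable J)
    (hlaw : Measure.map (fun ω => ((fun k => S k ω, J ω) : (Fin K → ℝ) × Fin K)) μ
      = (Measure.pi fun k => gammaLaw (a k)).prod (unifFin K)) :
    ∫ ω, Real.log (1 + S (J ω) ω) ∂μ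
      = 1 + (1 / (K : ℝ)) * ∑ k : Fin K,
          (1 - a k) * Real.exp (a k) * ∫ t in Set.Ioi (a k), Real.exp (-t) / t := by
  have hprob := fun k => isProbabilityMeasure_gammaLaw (ha k)
  have hfin := isFiniteMeasure_unifFin hK
  have hpair : Measurable fun ω => ((fun k => S k ω, J ω) : (Fin K → ℝ) × Fin K) :=
    (measurable_pi_lambda _ hSmeas).prodMk hJmeas
  have hf : Measurable fun p : (Fin K → ℝ) × Fin K => Real.log (1 + p.1 p.2) :=
    measurable_from_prod_countable_left fun k => by fun_prop
  have heval (k : Fin K) := measurePreserving_eval (fun k => gammaLaw (a k)) k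
  have hlogmeas : Measurable fun x : ℝ => Real.log (1 + x) := by fun_prop
  have hint : Integrable (fun p : (Fin K → ℝ) × Fin K => Real.log (1 + p.1 p.2))
      ((Measure.pi fun k => gammaLaw (a k)).prod (unifFin K)) := by
    refine (integrable_prod_iff' hf.aestronglyMeasurable).mpr
      ⟨.of_forall fun k => ?_, Integrable.of_finite⟩
    exact (heval k).integrable_comp_of_integrable (integrable_log_one_add_gammaLaw (ha k))
  calc ∫ ω, Real.log (1 + S (J ω) ω) ∂μ
      = ∫ p, Real.log (1 + p.1 p.2) ∂((Measure.pi fun k => gammaLaw (a k)).prod (unifFin K)) := by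
        rw [← hlaw, integral_map hpair.aemeasurable hf.aestronglyMeasurable]
    _ = ∫ k, ∫ s, Real.log (1 + s k) ∂(Measure.pi fun k => gammaLaw (a k)) ∂unifFin K :=
        integral_prod_symm _ hint
    _ = ∫ k, ∫ x, Real.log (1 + x) ∂gammaLaw (a k) ∂unifFin K := by
        congr 1
        funext k
        rw [← (heval k).map_eq,
          integral_map (heval k).measurable.aemeasurable hlogmeas.aestronglyMeasurable]
    _ = _ := by
        have hK0 : (K : ℝ) ≠ 0 := by exact_mod_cast (Nat.one_le_iff_ne_zero.mp hK)
        simp_rw [integral_unifFin, integral_log_one_add_gammaLaw (ha _),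
          Finset.sum_add_distrib, mul_add]
        simp [hK0]
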